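/- Let n ≥ 1, let Ω₁ be a real symmetric 2n×2n matrix, and let γ₁, …, γ_n : [0,∞) → (0,∞) be continuous with ∫₀^∞ γ_i(t) dt < ∞ and ∫₀^∞ t·γ_i(t) dt < ∞ for each i. Set γ̄_i = ∫₀^∞ γ_i(t) dt, Γ_{n+} = ∫₀^∞ max_i γ_i(t) dt, p(t) = (max_i γ_i(t))/Γ_{n+}, σ_min = min_i γ̄_i and σ_max = max_i γ̄_i. Suppose there exists a real number a > ‖J_n·Ω₁‖ such that ∫₀^∞ t·p(t) dt < |Re(λ₁) − a|^{2n}·σ_min / ( n·(2‖J_n·Ω₁‖ + 2a·Γ_{n+}/σ_min)^{2n} · (2a·Γ_{n+}/σ_min) · σ_max ), where λ₁ is the eigenvalue of J_n·Ω₁ with the largest real part. Then every continuously differentiable e : [0,∞) → ℝ^{2n} satisfying e'(t) = 2·J_n·Ω₁·e(t) − 2a·∫₀^t diag((γ₁(t−τ)/γ̄₁)·I₂, …, (γ_n(t−τ)/γ̄_n)·I₂)·e(τ) dτ for all t ≥ 0 converges to 0 as t → ∞. -/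

import Mathlib

open Matrix MeasureTheory Set Filter

/-- `J_k = I_k ⊗ J` where `J = [[0,1],[-1,0]]`: the `2k × 2k` block-diagonal matrix
with `2×2` blocks `J` (interleaved coordinate ordering). -/
def Jmat (k : ℕ) : Matrix (Fin (2*k)) (Fin (2*k)) ℝ :=
  Matrix.of fun i j =>
    if (i : ℕ) % 2 = 0 ∧ (j : ℕ) = (i : ℕ) + 1 then 1
    else if (i : ℕ) % 2 = 1 ∧ (j : ℕ) + 1 = (i : ℕ) then -1 else 0

/-- Operator norm of a real matrix induced by the Euclidean norm. -/
noncomputable def opNormR {N : ℕ} (M : Matrix (Fin N) (Fin N) ℝ) : ℝ :=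
  ‖LinearMap.toContinuousLinearMap (Matrix.toEuclideanLin M)‖

/-- Integrated decay estimate for `z' = μ z + w` with `Re μ ≤ -c`. -/
theorem integral_norm_le_of_hasDerivWithinAt_smul_add {E : Type*} [NormedAddCommGroup E]
    [InnerProductSpace ℂ E] {z w : ℝ → E} {μ : ℂ} {c T : ℝ} (hc : 0 < c) (hμ : μ.re ≤ -c)
    (hT : 0 ≤ T) (hz : ∀ t ≥ (0 : ℝ), HasDerivWithinAt z (μ • z t + w t) (Ici 0) t)
    (hw : IntervalIntegrable w volume 0 T) :
    c * ∫ t in (0 : ℝ)..T, ‖z t‖ ≤ ‖z 0‖ + ∫ t in (0 : ℝ)..T, ‖w t‖ := by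
  let _ := InnerProductSpace.rclikeToReal ℂ E
  have hzc : ContinuousOn z (Icc 0 T) := fun t ht =>
    ((hz t ht.1).continuousWithinAt).mono Icc_subset_Ici_self
  have hzi : IntervalIntegrable (fun t => ‖z t‖) volume 0 T :=
    ContinuousOn.intervalIntegrable (by rw [uIcc_of_le hT]; exact hzc.norm)
  have key : ∀ ε > (0 : ℝ), c * ∫ t in (0 : ℝ)..T, ‖z t‖ ≤
      (‖z 0‖ + ε + ∫ t in (0 : ℝ)..T, ‖w t‖) + c * T * ε := by
    intro ε hε
    set φ : ℝ → ℝ := fun t => √(‖z t‖ ^ 2 + ε ^ 2) with hφ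
    have hpos : ∀ t, 0 < ‖z t‖ ^ 2 + ε ^ 2 := fun t => by positivity
    have hφpos : ∀ t, 0 < φ t := fun t => Real.sqrt_pos.2 (hpos t)
    have hφsq : ∀ t, φ t ^ 2 = ‖z t‖ ^ 2 + ε ^ 2 := fun t => Real.sq_sqrt (hpos t).le
    have hφz : ∀ t, ‖z t‖ ≤ φ t := fun t => Real.le_sqrt_of_sq_le (by nlinarith [sq_nonneg ε])
    have hφε : ∀ t, ε ≤ φ t := fun t => Real.le_sqrt_of_sq_le (by nlinarith [sq_nonneg ‖z t‖])
    have hφc : ContinuousOn φ (Icc 0 T) := by fun_prop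
    have hd : ∀ t ∈ Ico (0 : ℝ) T, HasDerivWithinAt φ
        (2 * inner ℝ (z t) (μ • z t + w t) / (2 * φ t)) (Ioi t) t := by
      intro t ht
      have h1 := ((hz t ht.1).mono (Ioi_subset_Ici ht.1)).norm_sq.add_const (ε ^ 2)
      exact h1.sqrt (hpos t).ne'
    have hle : ∀ t, 2 * inner ℝ (z t) (μ • z t + w t) / (2 * φ t) ≤
        ‖w t‖ - c * ‖z t‖ + c * ε := by
      intro t
      have h1 : inner ℝ (z t) (μ • z t) = μ.re * ‖z t‖ ^ 2 := by
        rw [real_inner_eq_re_inner ℂ, inner_smul_right, inner_self_eq_norm_sq_to_K]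
        simp [← Complex.ofReal_pow]
      have h2 : inner ℝ (z t) (w t) ≤ ‖z t‖ * ‖w t‖ := real_inner_le_norm _ _
      have h3 : ‖z t‖ * ‖w t‖ ≤ φ t * ‖w t‖ := by gcongr; exact hφz t
      have h4 : μ.re * ‖z t‖ ^ 2 ≤ -c * ‖z t‖ ^ 2 := by gcongr
      rw [div_le_iff₀ (by linarith [hφpos t]), inner_add_right, h1]
      have h5 : c * ‖z t‖ * φ t - c * ε * φ t ≤ c * ‖z t‖ ^ 2 := by
        have := hφsq t
        have h6 : ‖z t‖ * φ t - ε * φ t ≤ ‖z t‖ ^ 2 := by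
          nlinarith [hφz t, hφε t, norm_nonneg (z t), hφpos t]
        nlinarith
      nlinarith
    have hint : IntervalIntegrable (fun t => ‖w t‖ - c * ‖z t‖ + c * ε) volume 0 T :=
      (hw.norm.sub (hzi.const_mul c)).add intervalIntegrable_const
    have h := intervalIntegral.sub_le_integral_of_hasDeriv_right_of_le hT hφc
      (fun t ht => hd t ⟨ht.1.le, ht.2⟩)
      ((intervalIntegrable_iff_integrableOn_Icc_of_le hT).1 hint) (fun t _ => hle t)
    rw [intervalIntegral.integral_add (hw.norm.sub (hzi.const_mul c)) intervalIntegrable_const,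
      intervalIntegral.integral_sub hw.norm (hzi.const_mul c),
      intervalIntegral.integral_const_mul, intervalIntegral.integral_const] at h
    have h0 : φ 0 ≤ ‖z 0‖ + ε := by
      apply Real.sqrt_le_iff.2 ⟨by positivity, ?_⟩
      nlinarith [norm_nonneg (z 0)]
    have := hφpos T
    simp only [smul_eq_mul, sub_zero] at h
    nlinarith
  refine le_of_forall_pos_le_add fun δ hδ => ?_
  have := key (δ / (1 + c * T)) (by positivity)
  have hx : δ / (1 + c * T) + c * T * (δ / (1 + c * T)) = δ := by
    have : 1 + c * T ≠ 0 := by positivity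
    field_simp
  linarith

/-- Integrated estimate for `z' = (2A - 2a) z + w` when `z` is annihilated by a product of factors
`A - λ`, each satisfying `Re λ ≤ a - δ`. -/
theorem exists_integral_norm_le_of_aeval_eq_zero {E : Type*} [NormedAddCommGroup E]
    [InnerProductSpace ℂ E] (A : E →L[ℂ] E) {a δ R : ℝ} (hδ : 0 < δ) (hR : 2 * δ ≤ R)
    (l : List ℂ) (hl : ∀ lam ∈ l, lam.re ≤ a - δ ∧ ∀ v, ‖(2 : ℂ) • (A v - lam • v)‖ ≤ R * ‖v‖)
    (z w : ℝ → E)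
    (hz : ∀ t ≥ (0 : ℝ),
      HasDerivWithinAt z ((2 : ℂ) • A (z t) - (2 * a : ℂ) • z t + w t) (Ici 0) t)
    (hw : ∀ T ≥ (0 : ℝ), IntervalIntegrable w volume 0 T)
    (h0 : ∀ t ≥ (0 : ℝ), (Polynomial.aeval A
      (l.map fun lam => Polynomial.X - Polynomial.C lam).prod) (z t) = 0) :
    ∃ C K : ℝ, 0 ≤ K ∧ 1 + R * K ≤ (l.length + 1) * (R / (2 * δ)) ^ l.length ∧
      ∀ T ≥ (0 : ℝ), ∫ t in (0 : ℝ)..T, ‖z t‖ ≤ C + K * ∫ t in (0 : ℝ)..T, ‖w t‖ := by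
  induction l generalizing z w with
  | nil =>
    refine ⟨0, 0, le_rfl, by simp, fun T hT => ?_⟩
    have : ∫ t in (0 : ℝ)..T, ‖z t‖ = ∫ t in (0 : ℝ)..T, (0 : ℝ) := by
      apply intervalIntegral.integral_congr
      intro t ht
      rw [uIcc_of_le hT] at ht
      simpa using h0 t ht.1
    simp [this]
  | cons lam l ih =>
    set N : E →L[ℂ] E := (2 : ℂ) • (A - lam • ContinuousLinearMap.id ℂ E) with hN
    have hNv : ∀ v, N v = (2 : ℂ) • (A v - lam • v) := fun v => by simp [hN]
    obtain ⟨hre, hnorm⟩ := hl lam (by simp)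
    have hNle : ∀ v, ‖N v‖ ≤ R * ‖v‖ := fun v => by rw [hNv]; exact hnorm v
    obtain ⟨C, K, hK, hKle, hb⟩ := ih (fun m hm => hl m (by simp [hm]))
      (fun t => N (z t)) (fun t => N (w t)) (fun t ht => by
        have := ((N.restrictScalars ℝ).hasFDerivAt.comp_hasDerivWithinAt t (hz t ht))
        refine this.congr_deriv ?_
        simp only [ContinuousLinearMap.coe_restrictScalars', hNv, map_add, map_sub, map_smul]
        module)
      (fun T hT => ⟨(N.restrictScalars ℝ).integrable_comp (hw T hT).1,
        (N.restrictScalars ℝ).integrable_comp (hw T hT).2⟩)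
      (fun t ht => by
        have := h0 t ht
        rw [List.map_cons, List.prod_cons, mul_comm, map_mul, mul_apply_eq_comp] at this
        rw [hNv, map_smul]
        simp only [map_sub, Polynomial.aeval_X, Polynomial.aeval_C,
          _root_.sub_apply] at this
        rw [smul_eq_zero]
        right
        rw [map_sub, ← this]
        simp [Algebra.algebraMap_eq_smul_one])
    have hR0 : 0 < R := by linarith
    refine ⟨(‖z 0‖ + C) / (2 * δ), (1 + R * K) / (2 * δ), by positivity, ?_, fun T hT => ?_⟩
    · set x := R / (2 * δ) with hx
      have hx1 : 1 ≤ x := (one_le_div (by positivity)).2 hR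
      have h1 : 1 + R * ((1 + R * K) / (2 * δ)) = 1 + x * (1 + R * K) := by rw [hx]; ring
      rw [h1, List.length_cons, pow_succ]
      push_cast
      have h2 : x * (1 + R * K) ≤ x * ((l.length + 1) * x ^ l.length) := by gcongr
      have h3 : 1 ≤ x ^ l.length * x := one_le_mul_of_one_le_of_one_le (one_le_pow₀ hx1) hx1
      nlinarith
    · have hNz : ContinuousOn (fun t => N (z t)) (uIcc 0 T) := by
        rw [uIcc_of_le hT]
        exact N.continuous.comp_continuousOn fun t ht =>
          ((hz t ht.1).continuousWithinAt).mono Icc_subset_Ici_self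
      have hNzi : IntervalIntegrable (fun t => N (z t)) volume 0 T := hNz.intervalIntegrable
      have h1 := integral_norm_le_of_hasDerivWithinAt_smul_add (z := z)
        (w := fun t => N (z t) + w t) (μ := 2 * lam - 2 * a) (c := 2 * δ) (by positivity)
        (by simp; linarith) hT (fun t ht => by
          convert hz t ht using 1
          rw [hNv]
          module) (hNzi.add (hw T hT))
      have h2 : ∫ t in (0 : ℝ)..T, ‖N (z t) + w t‖ ≤
          (∫ t in (0 : ℝ)..T, ‖N (z t)‖) + ∫ t in (0 : ℝ)..T, ‖w t‖ := by
        rw [← intervalIntegral.integral_add hNzi.norm (hw T hT).norm]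
        exact intervalIntegral.integral_mono_on hT (hNzi.add (hw T hT)).norm
          (hNzi.norm.add (hw T hT).norm) fun t _ => norm_add_le _ _
      have h3 : ∫ t in (0 : ℝ)..T, ‖N (w t)‖ ≤ R * ∫ t in (0 : ℝ)..T, ‖w t‖ := by
        rw [← intervalIntegral.integral_const_mul]
        refine intervalIntegral.integral_mono_on hT ?_ ((hw T hT).norm.const_mul R)
          fun t _ => hNle _
        exact IntervalIntegrable.norm ⟨(N.restrictScalars ℝ).integrable_comp (hw T hT).1,
          (N.restrictScalars ℝ).integrable_comp (hw T hT).2⟩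
      have h4 := hb T hT
      have h5 := mul_le_mul_of_nonneg_left h3 hK
      have h6 : (‖z 0‖ + C) / (2 * δ) + (1 + R * K) / (2 * δ) * ∫ t in (0 : ℝ)..T, ‖w t‖ =
          (‖z 0‖ + C + (1 + R * K) * ∫ t in (0 : ℝ)..T, ‖w t‖) / (2 * δ) := by ring
      rw [h6, le_div_iff₀ (by positivity)]
      nlinarith

/-- Integrated estimate for the increments of a nonnegative monotone function averaged against a
kernel. -/
theorem integral_integral_mul_sub_le {V g : ℝ → ℝ} (hV : Monotone V) (hV0 : ∀ t, 0 ≤ V t)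
    (hg0 : ∀ s > 0, 0 ≤ g s) (hg : IntegrableOn g (Ioi 0))
    (hsg : IntegrableOn (fun s => s * g s) (Ioi 0)) {T : ℝ} (hT : 0 ≤ T) :
    IntervalIntegrable (fun t => ∫ s in Ioi (0 : ℝ), g s * (V t - V (t - s))) volume 0 T ∧
    ∫ t in (0 : ℝ)..T, ∫ s in Ioi (0 : ℝ), g s * (V t - V (t - s)) ≤
      (∫ s in Ioi (0 : ℝ), s * g s) * V T := by
  have hVm := hV.measurable
  have hF : Integrable (Function.uncurry fun t s => g s * (V t - V (t - s)))
      ((volume.restrict (Ioc 0 T)).prod (volume.restrict (Ioi 0))) := by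
    have h1 : Integrable (fun q : ℝ × ℝ => V T * g q.2)
        ((volume.restrict (Ioc 0 T)).prod (volume.restrict (Ioi 0))) :=
      (integrable_const (V T)).mul_prod hg
    refine h1.mono ?_ ?_
    · apply AEStronglyMeasurable.mul
      · exact hg.aestronglyMeasurable.comp_snd
      · exact ((hVm.comp measurable_fst).sub
          (hVm.comp (measurable_fst.sub measurable_snd))).aestronglyMeasurable
    · rw [Measure.prod_restrict]
      filter_upwards [ae_restrict_mem (measurableSet_Ioc.prod measurableSet_Ioi)] with q hq
      obtain ⟨⟨hq1, hq2⟩, hq3⟩ := hq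
      have hq3 : 0 < q.2 := hq3
      have h2 : V (q.1 - q.2) ≤ V q.1 := hV (by linarith)
      have h3 : V q.1 ≤ V T := hV hq2
      have h4 := hV0 (q.1 - q.2)
      simp only [Function.uncurry, norm_mul, Real.norm_eq_abs]
      rw [abs_of_nonneg (sub_nonneg.2 h2), abs_of_nonneg (hV0 T), mul_comm]
      gcongr
      linarith
  refine ⟨(intervalIntegrable_iff_integrableOn_Ioc_of_le hT).2 hF.integral_prod_left, ?_⟩
  rw [intervalIntegral.integral_of_le hT, integral_integral_swap hF, ← integral_mul_const]
  refine setIntegral_mono_on hF.integral_prod_right (hsg.mul_const _) measurableSet_Ioi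
    fun s hs => ?_
  have hs : 0 < s := hs
  rw [integral_const_mul, ← intervalIntegral.integral_of_le hT, mul_comm s, mul_assoc]
  apply mul_le_mul_of_nonneg_left _ (hg0 s hs)
  have hVi : ∀ b c : ℝ, IntervalIntegrable V volume b c := fun b c => hV.intervalIntegrable
  have hVs : Monotone fun t => V (t - s) := fun _ _ h => hV (by linarith)
  rw [intervalIntegral.integral_sub (hVi _ _) hVs.intervalIntegrable,
    intervalIntegral.integral_comp_sub_right]
  have h1 := intervalIntegral.integral_add_adjacent_intervals (hVi (0 - s) (T - s)) (hVi (T - s) T)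
  have h2 := intervalIntegral.integral_add_adjacent_intervals (hVi (0 - s) 0) (hVi 0 T)
  have h3 : 0 ≤ ∫ t in (0 - s)..0, V t :=
    intervalIntegral.integral_nonneg (by linarith) fun t _ => hV0 t
  have h4 : ∫ t in (T - s)..T, V t ≤ ∫ t in (T - s)..T, V T :=
    intervalIntegral.integral_mono_on (by linarith) (hVi _ _) intervalIntegrable_const
      fun t ht => hV ht.2
  rw [intervalIntegral.integral_const, smul_eq_mul, sub_sub_cancel] at h4
  linarith

/-- The norm of the initial value plus the total variation accumulated by time `t`, for a function
started at time `0` from `x` with derivative `y`. -/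
noncomputable def accumulatedNorm {E : Type*} [NormedAddCommGroup E] (x : E) (y : ℝ → E) (t : ℝ) :
    ℝ :=
  if t < 0 then 0 else ‖x‖ + ∫ r in (0 : ℝ)..t, ‖y r‖

section accumulatedNorm

variable {E : Type*} [NormedAddCommGroup E]

theorem accumulatedNorm_of_nonneg (x : E) (y : ℝ → E) {t : ℝ} (ht : 0 ≤ t) :
    accumulatedNorm x y t = ‖x‖ + ∫ r in (0 : ℝ)..t, ‖y r‖ := by
  simp [accumulatedNorm, not_lt.2 ht]

theorem accumulatedNorm_nonneg (x : E) (y : ℝ → E) (t : ℝ) : 0 ≤ accumulatedNorm x y t := by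
  unfold accumulatedNorm
  split_ifs with h
  · exact le_rfl
  · have := intervalIntegral.integral_nonneg (μ := volume) (not_lt.1 h) fun r _ => norm_nonneg (y r)
    positivity

theorem accumulatedNorm_sub (x : E) {y : ℝ → E}
    (hy : ∀ T ≥ (0 : ℝ), IntervalIntegrable y volume 0 T) {s t : ℝ} (hs : 0 ≤ s) (ht : 0 ≤ t) :
    accumulatedNorm x y t - accumulatedNorm x y s = ∫ r in s..t, ‖y r‖ := by
  rw [accumulatedNorm_of_nonneg x y hs, accumulatedNorm_of_nonneg x y ht, add_sub_add_left_eq_sub,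
    intervalIntegral.integral_interval_sub_left (hy t ht).norm (hy s hs).norm]

theorem monotone_accumulatedNorm (x : E) {y : ℝ → E}
    (hy : ∀ T ≥ (0 : ℝ), IntervalIntegrable y volume 0 T) : Monotone (accumulatedNorm x y) := by
  intro s t hst
  by_cases hs : s < 0
  · simpa [accumulatedNorm, hs] using accumulatedNorm_nonneg x y t
  · have hs := not_lt.1 hs
    rw [← sub_nonneg, accumulatedNorm_sub x hy hs (hs.trans hst)]
    exact intervalIntegral.integral_nonneg hst fun r _ => norm_nonneg _

theorem norm_sub_indicator_le_accumulatedNorm_sub [NormedSpace ℝ E] [CompleteSpace E] {e y : ℝ → E}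
    (he : ∀ t ≥ (0 : ℝ), HasDerivWithinAt e (y t) (Ici 0) t)
    (hy : ∀ T ≥ (0 : ℝ), IntervalIntegrable y volume 0 T) {t s : ℝ} (ht : 0 ≤ t) (hs : 0 ≤ s) :
    ‖e t - (Ici 0).indicator e (t - s)‖ ≤
      accumulatedNorm (e 0) y t - accumulatedNorm (e 0) y (t - s) := by
  have hii : ∀ r ≥ (0 : ℝ), IntervalIntegrable y volume r t := fun r hr =>
    (hy r hr).symm.trans (hy t ht)
  have ftc : ∀ r, 0 ≤ r → r ≤ t → ‖e t - e r‖ ≤ ∫ q in r..t, ‖y q‖ := by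
    intro r hr hrt
    rw [← intervalIntegral.integral_eq_sub_of_hasDeriv_right_of_le hrt
      (fun q hq => (he q (hr.trans hq.1)).continuousWithinAt.mono fun x hx => hr.trans hx.1)
      (fun q hq => (he q (hr.trans hq.1.le)).mono (Ioi_subset_Ici (hr.trans hq.1.le))) (hii r hr)]
    exact intervalIntegral.norm_integral_le_integral_norm hrt
  by_cases hts : t - s < 0
  · rw [indicator_of_notMem (by simpa using hts), sub_zero, accumulatedNorm_of_nonneg _ _ ht]
    have h1 : ‖e t‖ ≤ ‖e 0‖ + ‖e t - e 0‖ := by simpa using norm_add_le (e 0) (e t - e 0)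
    have h2 := ftc 0 le_rfl ht
    simp only [accumulatedNorm, hts, if_true]
    linarith
  · have hts := not_lt.1 hts
    rw [indicator_of_mem (by simpa using hts), accumulatedNorm_sub _ hy hts ht]
    exact ftc _ hts (by linarith)

end accumulatedNorm

/-- Small-gain criterion: a solution of `e' = (2A - 2a) e + f` tends to zero if `f` is dominated by
sufficiently small averaged increments of `e`. -/
theorem tendsto_zero_of_small_gain {E : Type*} [NormedAddCommGroup E]
    [InnerProductSpace ℂ E] [CompleteSpace E] (A : E →L[ℂ] E) {a δ R : ℝ} (ha : 0 < a)
    (hδ : 0 < δ) (hR : 2 * δ ≤ R) (l : List ℂ)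
    (hl : ∀ lam ∈ l, lam.re ≤ a - δ ∧ ∀ v, ‖(2 : ℂ) • (A v - lam • v)‖ ≤ R * ‖v‖)
    (hprod : Polynomial.aeval A (l.map fun lam => Polynomial.X - Polynomial.C lam).prod = 0)
    (hB : ∀ v, ‖(2 : ℂ) • A v - (2 * a : ℂ) • v‖ ≤ R * ‖v‖)
    {e y : ℝ → E} (he : ∀ t ≥ (0 : ℝ), HasDerivWithinAt e (y t) (Ici 0) t)
    (hy : ∀ T ≥ (0 : ℝ), IntervalIntegrable y volume 0 T)
    {g : ℝ → ℝ} (hg0 : ∀ s > 0, 0 ≤ g s) (hg : IntegrableOn g (Ioi 0))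
    (hsg : IntegrableOn (fun s => s * g s) (Ioi 0))
    (hf : ∀ t ≥ (0 : ℝ), ‖y t - ((2 : ℂ) • A (e t) - (2 * a : ℂ) • e t)‖ ≤
      2 * a * ∫ s in Ioi (0 : ℝ), g s *
        (accumulatedNorm (e 0) y t - accumulatedNorm (e 0) y (t - s)))
    (hsmall : 2 * a * (∫ s in Ioi (0 : ℝ), s * g s) *
      ((l.length + 1) * (R / (2 * δ)) ^ l.length) < 1) :
    Tendsto e atTop (nhds 0) := by
  set f : ℝ → E := fun t => y t - ((2 : ℂ) • A (e t) - (2 * a : ℂ) • e t) with hfdef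
  set V := accumulatedNorm (e 0) y with hV
  set m := ∫ s in Ioi (0 : ℝ), s * g s with hm
  have hm0 : 0 ≤ m := setIntegral_nonneg measurableSet_Ioi fun s hs =>
    mul_nonneg (le_of_lt hs) (hg0 s hs)
  have hec : ∀ T ≥ (0 : ℝ), ContinuousOn e (uIcc 0 T) := fun T hT => by
    rw [uIcc_of_le hT]
    exact fun t ht => (he t ht.1).continuousWithinAt.mono Icc_subset_Ici_self
  have hei : ∀ T ≥ (0 : ℝ), IntervalIntegrable e volume 0 T := fun T hT =>
    (hec T hT).intervalIntegrable
  have hBc : Continuous fun v => (2 : ℂ) • A v - (2 * a : ℂ) • v := by fun_prop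
  have hBi : ∀ T ≥ (0 : ℝ), IntervalIntegrable (fun t => (2 : ℂ) • A (e t) - (2 * a : ℂ) • e t)
      volume 0 T := fun T hT => (hBc.comp_continuousOn (hec T hT)).intervalIntegrable
  have hfi : ∀ T ≥ (0 : ℝ), IntervalIntegrable f volume 0 T := fun T hT =>
    (hy T hT).sub (hBi T hT)
  obtain ⟨C, K, hK, hKle, hb⟩ := exists_integral_norm_le_of_aeval_eq_zero A hδ hR l hl e f
    (fun t ht => (he t ht).congr_deriv (by simp [hfdef])) hfi (fun t _ => by simp [hprod])
  have hR0 : 0 < R := by linarith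
  have hF : ∀ T ≥ (0 : ℝ), ∫ t in (0 : ℝ)..T, ‖f t‖ ≤ 2 * a * m * V T := by
    intro T hT
    obtain ⟨h1, h2⟩ := integral_integral_mul_sub_le (monotone_accumulatedNorm (e 0) hy)
      (accumulatedNorm_nonneg (e 0) y) hg0 hg hsg hT
    have h3 := intervalIntegral.integral_mono_on hT (hfi T hT).norm (h1.const_mul (2 * a))
      fun t ht => hf t ht.1
    rw [intervalIntegral.integral_const_mul] at h3
    calc _ ≤ _ := h3
      _ ≤ 2 * a * (m * V T) := by gcongr
      _ = _ := by ring
  set θ := 2 * a * m * (1 + R * K) with hθ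
  have hθ1 : θ < 1 :=
    (mul_le_mul_of_nonneg_left hKle (by positivity)).trans_lt hsmall
  have hVb : ∀ T ≥ (0 : ℝ), V T ≤ (‖e 0‖ + R * C) / (1 - θ) := by
    intro T hT
    rw [le_div_iff₀ (by linarith)]
    have h1 : ∫ t in (0 : ℝ)..T, ‖y t‖ ≤
        R * (∫ t in (0 : ℝ)..T, ‖e t‖) + ∫ t in (0 : ℝ)..T, ‖f t‖ := by
      rw [← intervalIntegral.integral_const_mul,
        ← intervalIntegral.integral_add ((hei T hT).norm.const_mul R) (hfi T hT).norm]
      refine intervalIntegral.integral_mono_on hT (hy T hT).norm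
        (((hei T hT).norm.const_mul R).add (hfi T hT).norm) fun t _ => ?_
      have h2 : y t = ((2 : ℂ) • A (e t) - (2 * a : ℂ) • e t) + f t := by simp [hfdef]
      have h3 := norm_add_le ((2 : ℂ) • A (e t) - (2 * a : ℂ) • e t) (f t)
      rw [← h2] at h3
      linarith [hB (e t)]
    have h2 : V T = ‖e 0‖ + ∫ t in (0 : ℝ)..T, ‖y t‖ := accumulatedNorm_of_nonneg _ _ hT
    have h3 := mul_le_mul_of_nonneg_left (hb T hT) hR0.le
    have h4 := mul_le_mul_of_nonneg_left (hF T hT) (by positivity : 0 ≤ 1 + R * K)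
    have h5 : θ * V T = (1 + R * K) * (2 * a * m * V T) := by rw [hθ]; ring
    nlinarith
  have hyI : IntegrableOn y (Ioi 0) := by
    refine integrableOn_Ioi_of_intervalIntegral_norm_bounded (l := atTop) (b := fun k : ℕ => (k : ℝ))
      ((‖e 0‖ + R * C) / (1 - θ)) 0 (fun k => (hy k k.cast_nonneg).1)
      tendsto_natCast_atTop_atTop (Eventually.of_forall fun k => ?_)
    have h1 := hVb k k.cast_nonneg
    have h2 : V k = ‖e 0‖ + ∫ t in (0 : ℝ)..k, ‖y t‖ := accumulatedNorm_of_nonneg _ _ k.cast_nonneg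
    linarith [norm_nonneg (e 0)]
  have heI : IntegrableOn e (Ioi 0) := by
    refine integrableOn_Ioi_of_intervalIntegral_norm_bounded (l := atTop) (b := fun k : ℕ => (k : ℝ))
      (C + K * (2 * a * m * ((‖e 0‖ + R * C) / (1 - θ)))) 0 (fun k => (hei k k.cast_nonneg).1)
      tendsto_natCast_atTop_atTop (Eventually.of_forall fun k => ?_)
    have h1 := hVb k k.cast_nonneg
    have h2 := hF k k.cast_nonneg
    refine (hb k k.cast_nonneg).trans ?_
    gcongr
    exact h2.trans (mul_le_mul_of_nonneg_left h1 (by positivity))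
  exact tendsto_zero_of_hasDerivAt_of_integrableOn_Ioi
    (fun t ht => (he t (le_of_lt ht)).hasDerivAt (Ici_mem_nhds ht)) hyI heI

/-- Rewriting of a causal convolution against a kernel of mass one in terms of increments. -/
theorem sub_integral_convolution_eq {k u : ℝ → ℝ} (hkc : ContinuousOn k (Ici 0))
    (hk : IntegrableOn k (Ioi 0)) (hk1 : ∫ s in Ioi (0 : ℝ), k s = 1)
    (hu : ContinuousOn u (Ici 0)) {t : ℝ} (ht : 0 ≤ t) :
    IntegrableOn (fun τ => k (t - τ) * u τ) (Icc 0 t) ∧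
    IntegrableOn (fun s => k s * (u t - (Ici 0).indicator u (t - s))) (Ioi 0) ∧
    u t - ∫ τ in Icc (0 : ℝ) t, k (t - τ) * u τ =
      ∫ s in Ioi (0 : ℝ), k s * (u t - (Ici 0).indicator u (t - s)) := by
  have h1 : ContinuousOn (fun τ => k (t - τ) * u τ) (Icc 0 t) :=
    (hkc.comp (by fun_prop) fun τ hτ => by simpa using hτ.2).mul (hu.mono Icc_subset_Ici_self)
  have h2 : ContinuousOn (fun s => k s * u (t - s)) (Icc 0 t) :=
    (hkc.mono Icc_subset_Ici_self).mul (hu.comp (by fun_prop) fun τ hτ => by simpa using hτ.2)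
  have h2i : IntegrableOn (fun s => k s * u (t - s)) (Ioc 0 t) :=
    h2.integrableOn_Icc.mono_set Ioc_subset_Icc_self
  have h3 : EqOn (fun s => k s * (u t - (Ici 0).indicator u (t - s)))
      (fun s => k s * u t - (Ioc 0 t).indicator (fun s => k s * u (t - s)) s) (Ioi 0) := by
    intro s hs
    have hs : 0 < s := hs
    by_cases h : s ≤ t
    · have : 0 ≤ t - s := by linarith
      simp [indicator, hs, h, mul_sub]
    · simp [indicator, h]
  have hku : IntegrableOn (fun s => k s * u t) (Ioi 0) := hk.mul_const _
  have hi : IntegrableOn ((Ioc 0 t).indicator fun s => k s * u (t - s)) (Ioi 0) :=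
    (h2i.integrable_indicator measurableSet_Ioc).integrableOn
  refine ⟨h1.integrableOn_Icc, (hku.sub hi).congr_fun h3.symm measurableSet_Ioi, ?_⟩
  rw [setIntegral_congr_fun measurableSet_Ioi h3, integral_sub hku hi, integral_mul_const, hk1,
    one_mul, setIntegral_indicator measurableSet_Ioc, inter_eq_right.2 Ioc_subset_Ioi_self,
    integral_Icc_eq_integral_Ioc, ← intervalIntegral.integral_of_le ht,
    ← intervalIntegral.integral_of_le ht]
  have := intervalIntegral.integral_comp_sub_left (a := 0) (b := t) (fun s => k s * u (t - s)) t
  simp only [sub_sub_cancel, sub_self, sub_zero] at this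
  rw [this]

/-- The inclusion of real vectors into the complex Euclidean space. -/
noncomputable def complexify (N : ℕ) : (Fin N → ℝ) →L[ℝ] EuclideanSpace ℂ (Fin N) :=
  LinearMap.toContinuousLinearMap
    { toFun := fun v => WithLp.toLp 2 fun i => (v i : ℂ)
      map_add' := fun v w => by ext i; simp
      map_smul' := fun c v => by ext i; simp }

theorem complexify_apply {N : ℕ} (v : Fin N → ℝ) (i : Fin N) : complexify N v i = (v i : ℂ) := rfl

theorem norm_complexify_mul_le {N : ℕ} {c v : Fin N → ℝ} {b : ℝ} (hb : 0 ≤ b)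
    (hc : ∀ i, |c i| ≤ b) : ‖complexify N (fun i => c i * v i)‖ ≤ b * ‖complexify N v‖ := by
  rw [EuclideanSpace.norm_eq, EuclideanSpace.norm_eq, ← Real.sqrt_sq hb, ← Real.sqrt_mul (sq_nonneg b),
    Finset.mul_sum]
  gcongr with i
  rw [complexify_apply, complexify_apply, ← mul_pow, Complex.ofReal_mul, norm_mul]
  gcongr
  simpa using hc i

theorem complexify_mulVec {N : ℕ} (M : Matrix (Fin N) (Fin N) ℝ) (v : Fin N → ℝ) :
    complexify N (M *ᵥ v) =
      Matrix.toEuclideanCLM (𝕜 := ℂ) (M.map Complex.ofReal) (complexify N v) := by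
  ext i
  simp [complexify_apply, Matrix.mulVec, dotProduct]

theorem tendsto_zero_of_complexify {N : ℕ} {e : ℝ → Fin N → ℝ}
    (h : Tendsto (fun t => complexify N (e t)) atTop (nhds 0)) : Tendsto e atTop (nhds 0) := by
  rw [tendsto_pi_nhds]
  intro i
  have hc : Continuous fun v : EuclideanSpace ℂ (Fin N) => (v i).re := by fun_prop
  simpa [Function.comp_def, complexify_apply] using (hc.tendsto 0).comp h

theorem opNormR_nonneg {N : ℕ} (M : Matrix (Fin N) (Fin N) ℝ) : 0 ≤ opNormR M := norm_nonneg _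

theorem norm_toEuclideanCLM_map_ofReal_le {N : ℕ} (M : Matrix (Fin N) (Fin N) ℝ)
    (v : EuclideanSpace ℂ (Fin N)) :
    ‖Matrix.toEuclideanCLM (𝕜 := ℂ) (M.map Complex.ofReal) v‖ ≤ opNormR M * ‖v‖ := by
  set x : EuclideanSpace ℝ (Fin N) := WithLp.toLp 2 fun i => (v i).re with hx
  set y : EuclideanSpace ℝ (Fin N) := WithLp.toLp 2 fun i => (v i).im with hy
  have hop : ∀ u : EuclideanSpace ℝ (Fin N), ‖Matrix.toEuclideanLin M u‖ ≤ opNormR M * ‖u‖ :=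
    fun u => (LinearMap.toContinuousLinearMap (Matrix.toEuclideanLin M)).le_opNorm u
  have hsplit : ‖v‖ ^ 2 = ‖x‖ ^ 2 + ‖y‖ ^ 2 := by
    simp only [EuclideanSpace.norm_sq_eq, ← Finset.sum_add_distrib, hx, hy]
    refine Finset.sum_congr rfl fun i _ => ?_
    rw [Complex.sq_norm, Complex.normSq_apply]
    simp [sq]
  have hMsplit : ‖Matrix.toEuclideanCLM (𝕜 := ℂ) (M.map Complex.ofReal) v‖ ^ 2 =
      ‖Matrix.toEuclideanLin M x‖ ^ 2 + ‖Matrix.toEuclideanLin M y‖ ^ 2 := by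
    simp only [EuclideanSpace.norm_sq_eq, ← Finset.sum_add_distrib]
    refine Finset.sum_congr rfl fun i _ => ?_
    rw [Complex.sq_norm, Complex.normSq_apply]
    simp [sq, hx, hy, Matrix.mulVec, dotProduct]
  refine le_of_sq_le_sq ?_ (mul_nonneg (opNormR_nonneg M) (norm_nonneg v))
  rw [hMsplit, mul_pow, hsplit, mul_add, ← mul_pow, ← mul_pow]
  gcongr
  · exact hop x
  · exact hop y

theorem norm_le_opNormR_of_mem_spectrum {N : ℕ} (hN : 0 < N) {M : Matrix (Fin N) (Fin N) ℝ} {μ : ℂ}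
    (hμ : μ ∈ spectrum ℂ (M.map Complex.ofReal)) : ‖μ‖ ≤ opNormR M := by
  have : Nonempty (Fin N) := ⟨⟨0, hN⟩⟩
  rw [← AlgEquiv.spectrum_eq (Matrix.toEuclideanCLM (n := Fin N) (𝕜 := ℂ))] at hμ
  exact (spectrum.norm_le_norm_of_mem hμ).trans
    (ContinuousLinearMap.opNorm_le_bound _ (opNormR_nonneg M) (norm_toEuclideanCLM_map_ofReal_le M))

/-- Stability of a linear equation with distributed delay under a smallness condition on the first
moment of the delay kernel. -/
theorem tendsto_zero_of_distributed_delay {N : ℕ} (hN : 0 < N) (M : Matrix (Fin N) (Fin N) ℝ)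
    {a r R : ℝ} (ha : opNormR M < a) (hra : r < a)
    (hspec : ∀ μ ∈ spectrum ℂ (M.map Complex.ofReal), μ.re ≤ r)
    (hrR : 2 * (a - r) ≤ R) (hR : 2 * opNormR M + 2 * a ≤ R)
    {k : Fin N → ℝ → ℝ} (hkc : ∀ i, ContinuousOn (k i) (Ici 0))
    (hk : ∀ i, IntegrableOn (k i) (Ioi 0)) (hk1 : ∀ i, ∫ s in Ioi (0 : ℝ), k i s = 1)
    {g : ℝ → ℝ} (hkg : ∀ i, ∀ s > 0, |k i s| ≤ g s) (hg : IntegrableOn g (Ioi 0))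
    (hsg : IntegrableOn (fun s => s * g s) (Ioi 0))
    (hsmall : 2 * a * (∫ s in Ioi (0 : ℝ), s * g s) *
      ((N + 1) * (R / (2 * (a - r))) ^ N) < 1)
    {e : ℝ → Fin N → ℝ}
    (he : ∀ t ≥ (0 : ℝ), HasDerivWithinAt e (((2 : ℝ) • M) *ᵥ e t - (2 * a) •
      ∫ τ in Icc (0 : ℝ) t, (Matrix.diagonal fun i => k i (t - τ)) *ᵥ e τ) (Ici 0) t) :
    Tendsto e atTop (nhds 0) := by
  have ha0 : 0 < a := (opNormR_nonneg M).trans_lt ha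
  have hg0 : ∀ s > 0, 0 ≤ g s := fun s hs => (abs_nonneg _).trans (hkg ⟨0, hN⟩ s hs)
  set A := Matrix.toEuclideanCLM (𝕜 := ℂ) (M.map Complex.ofReal) with hA
  have hAle : ∀ v, ‖A v‖ ≤ opNormR M * ‖v‖ := norm_toEuclideanCLM_map_ofReal_le M
  set l := (M.map Complex.ofReal).charpoly.roots.toList with hl
  have hsplit := IsAlgClosed.splits (M.map Complex.ofReal).charpoly
  have hmonic := Matrix.charpoly_monic (M.map Complex.ofReal)
  have hlen : l.length = N := by
    rw [hl, Multiset.length_toList, ← hsplit.natDegree_eq_card_roots,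
      Matrix.charpoly_natDegree_eq_dim, Fintype.card_fin]
  have hprod : Polynomial.aeval A (l.map fun lam => Polynomial.X - Polynomial.C lam).prod = 0 := by
    have h1 : (l.map fun lam => Polynomial.X - Polynomial.C lam).prod =
        (M.map Complex.ofReal).charpoly := by
      conv_rhs => rw [hsplit.eq_prod_roots_of_monic hmonic]
      rw [hl, ← Multiset.prod_coe, ← Multiset.map_coe, Multiset.coe_toList]
    rw [h1, hA, Polynomial.aeval_algHom_apply, Matrix.aeval_self_charpoly, map_zero]
  have hlspec : ∀ lam ∈ l, lam ∈ spectrum ℂ (M.map Complex.ofReal) := fun lam h => by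
    rw [Matrix.mem_spectrum_iff_isRoot_charpoly]
    exact Polynomial.isRoot_of_mem_roots (Multiset.mem_toList.1 h)
  set L := complexify N with hL
  set I : ℝ → Fin N → ℝ := fun t =>
    ∫ τ in Icc (0 : ℝ) t, (Matrix.diagonal fun i => k i (t - τ)) *ᵥ e τ with hI
  set y : ℝ → EuclideanSpace ℂ (Fin N) := fun t =>
    L (((2 : ℝ) • M) *ᵥ e t - (2 * a) • I t) with hy
  have hLe : ∀ t ≥ (0 : ℝ), HasDerivWithinAt (fun t => L (e t)) (y t) (Ici 0) t := fun t ht =>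
    L.hasFDerivAt.comp_hasDerivWithinAt t (he t ht)
  have hec : ∀ i, ContinuousOn (fun t => e t i) (Ici 0) := fun i t ht =>
    (continuous_apply i).continuousAt.comp_continuousWithinAt (he t ht).continuousWithinAt
  have hfeq : ∀ t ≥ (0 : ℝ), y t - ((2 : ℂ) • A (L (e t)) - (2 * a : ℂ) • L (e t)) =
      (2 * a) • ∫ s in Ioi (0 : ℝ), L fun i => k i s * (e t - (Ici 0).indicator e (t - s)) i := by
    intro t ht
    have hs := fun i => sub_integral_convolution_eq (hkc i) (hk i) (hk1 i) (hec i) ht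
    have hind : ∀ i r, (Ici 0).indicator e r i = (Ici 0).indicator (fun t => e t i) r :=
      fun i r => by by_cases h : r ∈ Ici (0 : ℝ) <;> simp [h]
    have hint : ∀ i, IntegrableOn (fun s => k i s * (e t - (Ici 0).indicator e (t - s)) i)
        (Ioi 0) := fun i => by
      simpa only [Pi.sub_apply, hind] using (hs i).2.1
    rw [L.integral_comp_comm (Integrable.of_eval hint)]
    have hvec : e t - I t =
        ∫ s in Ioi (0 : ℝ), fun i => k i s * (e t - (Ici 0).indicator e (t - s)) i := by
      ext i
      rw [eval_integral hint, Pi.sub_apply, hI]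
      simp only
      rw [eval_integral (fun j => by simp only [Matrix.mulVec_diagonal]; exact (hs j).1)]
      simpa only [Matrix.mulVec_diagonal, Pi.sub_apply, hind] using (hs i).2.2
    rw [← hvec, hy]
    simp only [map_sub, map_smul, hL, Matrix.smul_mulVec, complexify_mulVec, ← hA]
    ext i
    simp
    ring
  have hbound : ∀ t ≥ (0 : ℝ), ∀ W : ℝ → ℝ, IntegrableOn (fun s => g s * W s) (Ioi 0) →
      (∀ s > 0, ‖L (e t) - (Ici 0).indicator (fun t => L (e t)) (t - s)‖ ≤ W s) →
      ‖y t - ((2 : ℂ) • A (L (e t)) - (2 * a : ℂ) • L (e t))‖ ≤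
        2 * a * ∫ s in Ioi (0 : ℝ), g s * W s := by
    intro t ht W hW hle
    rw [hfeq t ht, norm_smul, Real.norm_of_nonneg (by positivity)]
    gcongr
    refine norm_integral_le_of_norm_le hW ?_
    filter_upwards [ae_restrict_mem measurableSet_Ioi] with s hs
    refine (norm_complexify_mul_le (hg0 s hs) fun i => hkg i s hs).trans ?_
    gcongr
    · exact hg0 s hs
    · refine le_trans (le_of_eq ?_) (hle s hs)
      rw [map_sub]
      congr 2
      by_cases h : t - s ∈ Ici (0 : ℝ) <;> simp [h, hL]
  have hyi : ∀ T ≥ (0 : ℝ), IntervalIntegrable y volume 0 T := by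
    intro T hT
    have hLc : ContinuousOn (fun t => L (e t)) (Icc 0 T) := fun t ht =>
      (hLe t ht.1).continuousWithinAt.mono Icc_subset_Ici_self
    obtain ⟨B, hB⟩ := isCompact_Icc.exists_bound_of_continuousOn hLc
    have hB0 : 0 ≤ B := (norm_nonneg _).trans (hB 0 ⟨le_rfl, hT⟩)
    rw [intervalIntegrable_iff_integrableOn_Ioc_of_le hT]
    refine Integrable.of_bound ?_ (2 * a * (∫ s in Ioi (0 : ℝ), g s * (2 * B)) +
      (2 * (opNormR M * B) + 2 * a * B)) ?_
    · refine (stronglyMeasurable_deriv fun t => L (e t)).aestronglyMeasurable.congr ?_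
      filter_upwards [ae_restrict_mem measurableSet_Ioc] with t ht
      exact ((hLe t ht.1.le).hasDerivAt (Ici_mem_nhds ht.1)).deriv
    · filter_upwards [ae_restrict_mem measurableSet_Ioc] with t ht
      have h1 := hbound t ht.1.le (fun _ => 2 * B) (hg.mul_const _) fun s hs => by
        refine (norm_sub_le _ _).trans ?_
        have h2 : ‖(Ici 0).indicator (fun t => L (e t)) (t - s)‖ ≤ B := by
          by_cases h : t - s ∈ Ici (0 : ℝ)
          · rw [indicator_of_mem h]
            exact hB _ ⟨h, by linarith [ht.2]⟩
          · rw [indicator_of_notMem h, norm_zero]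
            exact hB0
        linarith [hB t ⟨ht.1.le, ht.2⟩]
      have h2 : ‖(2 : ℂ) • A (L (e t)) - (2 * a : ℂ) • L (e t)‖ ≤
          2 * (opNormR M * B) + 2 * a * B := by
        refine (norm_sub_le _ _).trans ?_
        rw [norm_smul, norm_smul]
        have h3 : ‖(2 * a : ℂ)‖ = 2 * a := by
          rw [norm_mul, Complex.norm_real, Real.norm_of_nonneg ha0.le]; simp
        have h4 := hB t ⟨ht.1.le, ht.2⟩
        rw [h3, Complex.norm_ofNat]
        have h5 := (hAle (L (e t))).trans (mul_le_mul_of_nonneg_left h4 (opNormR_nonneg M))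
        gcongr
      have h3 := norm_sub_norm_le (y t) ((2 : ℂ) • A (L (e t)) - (2 * a : ℂ) • L (e t))
      linarith
  refine tendsto_zero_of_complexify (tendsto_zero_of_small_gain A ha0 (sub_pos.2 hra) hrR l
    (fun lam h => ⟨by linarith [hspec lam (hlspec lam h)], fun v => ?_⟩) hprod (fun v => ?_) hLe hyi
    hg0 hg hsg (fun t ht => ?_) (by rw [hlen]; exact hsmall))
  · have h1 := norm_le_opNormR_of_mem_spectrum hN (hlspec lam h)
    have h2 : ‖A v - lam • v‖ ≤ opNormR M * ‖v‖ + opNormR M * ‖v‖ := by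
      refine (norm_sub_le _ _).trans (add_le_add (hAle v) ?_)
      rw [norm_smul]
      gcongr
    rw [norm_smul, Complex.norm_ofNat]
    nlinarith [norm_nonneg v]
  · refine (norm_sub_le _ _).trans ?_
    have h3 : ‖(2 * a : ℂ)‖ = 2 * a := by
      rw [norm_mul, Complex.norm_real, Real.norm_of_nonneg ha0.le]; simp
    rw [norm_smul, norm_smul, h3, Complex.norm_ofNat]
    nlinarith [norm_nonneg v, hAle v]
  · have hmono := monotone_accumulatedNorm (L (e 0)) hyi
    refine hbound t ht _ ?_ fun s hs =>
      norm_sub_indicator_le_accumulatedNorm_sub hLe hyi ht (le_of_lt hs)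
    refine hg.mul_bdd (c := accumulatedNorm (L (e 0)) y t) ?_ ?_
    · exact (measurable_const.sub
        (hmono.measurable.comp (measurable_const.sub measurable_id))).aestronglyMeasurable
    · filter_upwards [ae_restrict_mem measurableSet_Ioi] with s hs
      have hs : 0 < s := hs
      have h1 := accumulatedNorm_nonneg (L (e 0)) y (t - s)
      have h2 : accumulatedNorm (L (e 0)) y (t - s) ≤ accumulatedNorm (L (e 0)) y t :=
        hmono (by linarith)
      rw [Real.norm_of_nonneg (by linarith)]
      linarith

theorem integrable_finset_sup' {α ι : Type*} [MeasurableSpace α] {μ : Measure α} {s : Finset ι}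
    (hs : s.Nonempty) {f : ι → α → ℝ} (hf : ∀ i ∈ s, Integrable (f i) μ) :
    Integrable (fun x => s.sup' hs fun i => f i x) μ := by
  have h := Finset.sup'_induction hs f (p := fun u => Integrable u μ)
    (fun _ h₁ _ h₂ => h₁.sup h₂) hf
  convert h using 1
  ext x
  rw [Finset.sup'_apply]

/-- A first-moment bound of small-gain form follows from the explicit moment condition. -/
theorem small_gain_of_moment_lt {n : ℕ} (hn : 1 ≤ n) {m q δ R σmin σmax : ℝ} (hm : 0 ≤ m)
    (hq : 0 < q) (hδ : 0 < δ) (hR : 0 < R) (hσ : 0 < σmin) (hσσ : σmin ≤ σmax)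
    (h : m < δ ^ (2 * n) * σmin / (n * R ^ (2 * n) * q * σmax)) :
    q * m * ((((2 * n : ℕ) : ℝ) + 1) * (R / (2 * δ)) ^ (2 * n)) < 1 := by
  have hσmax : 0 < σmax := hσ.trans_le hσσ
  have hn1 : (1 : ℝ) ≤ n := by exact_mod_cast hn
  have hn0 : (0 : ℝ) < n := by linarith
  rw [lt_div_iff₀ (by positivity)] at h
  have hX : (n : ℝ) * (q * m * R ^ (2 * n)) < δ ^ (2 * n) := by
    refine lt_of_mul_lt_mul_right (a := σmax) ?_ hσmax.le
    have h1 : δ ^ (2 * n) * σmin ≤ δ ^ (2 * n) * σmax := by gcongr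
    linarith
  have hX0 : 0 ≤ q * m * R ^ (2 * n) := by positivity
  have h4 : (4 : ℝ) ≤ 2 ^ (2 * n) := by
    calc (4 : ℝ) = 2 ^ (2 * 1) := by norm_num
      _ ≤ 2 ^ (2 * n) := pow_le_pow_right₀ (by norm_num) (by omega)
  have hD : 0 < δ ^ (2 * n) := by positivity
  have h5 : q * m * ((((2 * n : ℕ) : ℝ) + 1) * (R / (2 * δ)) ^ (2 * n)) =
      (2 * n + 1) * (q * m * R ^ (2 * n)) / (2 ^ (2 * n) * δ ^ (2 * n)) := by
    rw [div_pow, mul_pow]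
    push_cast
    ring
  rw [h5, div_lt_one (by positivity)]
  nlinarith

theorem stmt_18 {n : ℕ} (hn : 1 ≤ n)
    (Ω₁ : Matrix (Fin (2*n)) (Fin (2*n)) ℝ) (hΩ₁sym : Ω₁ᵀ = Ω₁)
    (γ : Fin n → ℝ → ℝ)
    (hγcont : ∀ i, ContinuousOn (γ i) (Set.Ici 0))
    (hγpos : ∀ i, ∀ t ≥ (0:ℝ), 0 < γ i t)
    (hγint : ∀ i, IntegrableOn (γ i) (Set.Ioi 0))
    (hγtint : ∀ i, IntegrableOn (fun t => t * γ i t) (Set.Ioi 0))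
    (γbar : Fin n → ℝ) (hγbar : ∀ i, γbar i = ∫ t in Set.Ioi (0:ℝ), γ i t)
    (Γnp : ℝ) (hΓnp : Γnp = ∫ t in Set.Ioi (0:ℝ),
      Finset.univ.sup' ⟨⟨0, hn⟩, Finset.mem_univ _⟩ (fun i => γ i t))
    (p : ℝ → ℝ) (hp : ∀ t, p t =
      (Finset.univ.sup' ⟨⟨0, hn⟩, Finset.mem_univ _⟩ (fun i => γ i t)) / Γnp)
    (σmin σmax : ℝ)
    (hσmin : σmin = Finset.univ.inf' ⟨⟨0, hn⟩, Finset.mem_univ _⟩ γbar)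
    (hσmax : σmax = Finset.univ.sup' ⟨⟨0, hn⟩, Finset.mem_univ _⟩ γbar)
    (lam1 : ℂ)
    (hlam1 : lam1 ∈ spectrum ℂ ((Jmat n * Ω₁).map Complex.ofReal))
    (hlam1max : ∀ μ ∈ spectrum ℂ ((Jmat n * Ω₁).map Complex.ofReal), μ.re ≤ lam1.re)
    (a : ℝ) (ha : opNormR (Jmat n * Ω₁) < a)
    (hcond : (∫ t in Set.Ioi (0:ℝ), t * p t) <
      |lam1.re - a| ^ (2*n) * σmin /
        (n * (2 * opNormR (Jmat n * Ω₁) + 2 * a * Γnp / σmin) ^ (2*n) *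
          (2 * a * Γnp / σmin) * σmax))
    (e : ℝ → Fin (2*n) → ℝ)
    (he : ∀ t ≥ (0:ℝ), HasDerivWithinAt e
      (((2:ℝ) • (Jmat n * Ω₁)).mulVec (e t) -
        (2*a) • ∫ τ in Set.Icc (0:ℝ) t,
          (Matrix.diagonal fun i : Fin (2*n) =>
            γ ⟨(i:ℕ)/2, by have := i.isLt; omega⟩ (t - τ) /
              γbar ⟨(i:ℕ)/2, by have := i.isLt; omega⟩).mulVec (e τ))
      (Set.Ici 0) t) :
    Tendsto e atTop (nhds 0) := by
  have hN : 0 < 2 * n := by omega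
  have hne : (Finset.univ : Finset (Fin n)).Nonempty := ⟨⟨0, hn⟩, Finset.mem_univ _⟩
  set M := Jmat n * Ω₁
  set S : ℝ → ℝ := fun t => Finset.univ.sup' ⟨⟨0, hn⟩, Finset.mem_univ _⟩ (fun i => γ i t)
  have hγS : ∀ i t, γ i t ≤ S t := fun i t =>
    Finset.le_sup' (fun i => γ i t) (Finset.mem_univ i)
  have hSpos : ∀ t ≥ (0 : ℝ), 0 < S t := fun t ht =>
    (hγpos ⟨0, hn⟩ t ht).trans_le (hγS _ t)
  have hγdiv : ∀ i b, IntegrableOn (fun s => γ i s / b) (Ioi 0) := fun i b =>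
    Integrable.div_const (hγint i) b
  have hSint : IntegrableOn S (Ioi 0) := integrable_finset_sup' hne fun i _ => hγint i
  have htS : IntegrableOn (fun t => t * S t) (Ioi 0) := by
    refine IntegrableOn.congr_fun (integrable_finset_sup' hne fun i _ => hγtint i) ?_
      measurableSet_Ioi
    intro t ht
    exact (Finset.apply_sup'_eq_sup'_comp hne (fun x => t * x)
      (fun x y => mul_max_of_nonneg x y (le_of_lt ht))).symm
  have hbarpos : ∀ i, 0 < γbar i := by
    intro i
    rw [hγbar i, setIntegral_pos_iff_support_of_nonneg_ae _ (hγint i)]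
    · have : Ioi (0 : ℝ) ⊆ Function.support (γ i) := fun t ht => (hγpos i t (le_of_lt ht)).ne'
      rw [inter_eq_right.2 this]
      simp
    · filter_upwards [ae_restrict_mem measurableSet_Ioi] with t ht
      exact (hγpos i t (le_of_lt ht)).le
  have hσle : ∀ i, σmin ≤ γbar i := fun i => by
    rw [hσmin]; exact Finset.inf'_le _ (Finset.mem_univ i)
  have hσpos : 0 < σmin := by
    rw [hσmin]
    exact (Finset.lt_inf'_iff _).2 fun i _ => hbarpos i
  have hσσ : σmin ≤ σmax := by
    refine (hσle ⟨0, hn⟩).trans ?_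
    rw [hσmax]
    exact Finset.le_sup' _ (Finset.mem_univ _)
  have hσΓ : σmin ≤ Γnp := by
    refine (hσle ⟨0, hn⟩).trans ?_
    rw [hγbar, hΓnp]
    exact setIntegral_mono (hγint _) hSint fun t => hγS _ t
  have hΓpos : 0 < Γnp := hσpos.trans_le hσΓ
  have ha0 : 0 < a := (opNormR_nonneg M).trans_lt ha
  have hre : |lam1.re| ≤ opNormR M :=
    (Complex.abs_re_le_norm lam1).trans (norm_le_opNormR_of_mem_spectrum hN hlam1)
  obtain ⟨hre₁, hre₂⟩ := abs_le.1 hre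
  have hra : lam1.re < a := hre₂.trans_lt ha
  have hq : 2 * a ≤ 2 * a * Γnp / σmin := by
    rw [le_div_iff₀ hσpos]
    gcongr
  have hmom : ∫ s in Ioi (0 : ℝ), s * (S s / σmin) =
      Γnp / σmin * ∫ t in Ioi (0 : ℝ), t * p t := by
    rw [← integral_const_mul]
    congr 1
    ext s
    rw [show p s = S s / Γnp from hp s]
    field_simp
  have hm0 : 0 ≤ ∫ t in Ioi (0 : ℝ), t * p t := by
    refine setIntegral_nonneg measurableSet_Ioi fun t ht => ?_
    rw [hp t]
    exact mul_nonneg (le_of_lt ht) (div_nonneg (hSpos t (le_of_lt ht)).le hΓpos.le)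
  rw [abs_sub_comm, abs_of_pos (sub_pos.2 hra)] at hcond
  have hgain := small_gain_of_moment_lt hn hm0 (by positivity) (sub_pos.2 hra)
    (by have := opNormR_nonneg M; positivity) hσpos hσσ hcond
  refine tendsto_zero_of_distributed_delay hN M ha hra hlam1max
    (R := 2 * opNormR M + 2 * a * Γnp / σmin) (by linarith) (by linarith)
    (k := fun i s => γ ⟨(i : ℕ) / 2, by have := i.isLt; omega⟩ s /
      γbar ⟨(i : ℕ) / 2, by have := i.isLt; omega⟩)
    (fun i => (hγcont _).div_const _) (fun i => hγdiv _ _) (fun i => ?_)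
    (g := fun s => S s / σmin) (fun i s hs => ?_) (Integrable.div_const hSint _) ?_ ?_ he
  · rw [integral_div, ← hγbar, div_self (hbarpos _).ne']
  · rw [abs_of_pos (div_pos (hγpos _ s hs.le) (hbarpos _))]
    exact div_le_div₀ (hSpos s hs.le).le (hγS _ s) hσpos (hσle _)
  · have h := Integrable.div_const htS σmin
    simp only [mul_div_assoc] at h
    exact h
  · rw [hmom]
    convert hgain using 2
    ring
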